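/- For every α ∈ (0,1), Var(U^α) = (1/12)·k(k+1)·α·(2 + 4k − 3αk − 3αk²) where k = ⌊1/α⌋. In particular, if 1/α is an integer then Var(U^α) = (1 − α²)/(12α²). -/

import Mathlib

open MeasureTheory ProbabilityTheory

/-- The probability mass function of the random variable `U^α`: it takes each value
`l = 0, 1, …, ⌊1/α⌋ − 1` with probability `α` and the value `⌊1/α⌋` with probability
`1 − ⌊1/α⌋·α`. -/
noncomputable def uPMF (α : ℝ) (l : ℤ) : ℝ :=
  if 0 ≤ l ∧ l < ⌊1/α⌋ then α else if l = ⌊1/α⌋ then 1 - ⌊1/α⌋ * α else 0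

/-- The expectation of a function of an integer random variable almost surely in `{0, …, n}`. -/
theorem integral_comp_eq_sum_range {Ω : Type*} [MeasurableSpace Ω] {μ : Measure Ω}
    [IsFiniteMeasure μ] {U : Ω → ℤ} (hU : Measurable U) {n : ℕ}
    (hn : ∀ᵐ ω ∂μ, U ω ∈ Set.Icc (0 : ℤ) n) (f : ℤ → ℝ) :
    ∫ ω, f (U ω) ∂μ = ∑ l ∈ Finset.range (n + 1), μ.real {ω | U ω = l} * f l := by
  have hmeas (l : ℤ) : MeasurableSet {ω | U ω = l} := hU (measurableSet_singleton l)
  have hsum : (fun ω => f (U ω)) =ᵐ[μ] fun ω =>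
      ∑ l ∈ Finset.range (n + 1), {ω | U ω = (l : ℤ)}.indicator (fun _ => f l) ω := by
    filter_upwards [hn] with ω hω
    lift U ω to ℕ using hω.1 with m hm
    have hmn : m ∈ Finset.range (n + 1) := by
      have := hω.2
      simp only [Finset.mem_range]
      omega
    rw [Finset.sum_eq_single_of_mem m hmn]
    · simp [Set.indicator, hm]
    · intro l _ hl
      have : (m : ℤ) ≠ l := by exact_mod_cast hl.symm
      simp [Set.indicator, ← hm, this]
  rw [integral_congr_ae hsum, integral_finsetSum]
  · simp [integral_indicator_const, hmeas]
  · exact fun l _ => (integrable_const _).indicator (hmeas l)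

theorem sum_range_cast_real (n : ℕ) :
    ∑ l ∈ Finset.range n, (l : ℝ) = n * (n - 1) / 2 := by
  induction n with
  | zero => simp
  | succ n ih => rw [Finset.sum_range_succ, ih]; push_cast; ring

theorem sum_range_cast_sq_real (n : ℕ) :
    ∑ l ∈ Finset.range n, (l : ℝ) ^ 2 = n * (n - 1) * (2 * n - 1) / 6 := by
  induction n with
  | zero => simp
  | succ n ih => rw [Finset.sum_range_succ, ih]; push_cast; ring

/-- For every `α ∈ (0,1)`,
`Var(U^α) = (1/12)·k(k+1)·α·(2 + 4k − 3αk − 3αk²)` where `k = ⌊1/α⌋`; in particular, if `1/α` is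
an integer then `Var(U^α) = (1 − α²)/(12α²)`. -/
theorem stmt6 {α : ℝ} (hα : α ∈ Set.Ioo (0:ℝ) 1)
    {Ω : Type*} [MeasurableSpace Ω] (μ : Measure Ω) [IsProbabilityMeasure μ]
    (U : Ω → ℤ) (hU : Measurable U)
    (hdist : ∀ l : ℤ, μ {ω | U ω = l} = ENNReal.ofReal (uPMF α l)) :
    variance (fun ω => (U ω : ℝ)) μ =
      (1/12) * ⌊1/α⌋ * (⌊1/α⌋ + 1) * α * (2 + 4 * ⌊1/α⌋ - 3 * α * ⌊1/α⌋ - 3 * α * ⌊1/α⌋^2) ∧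
    ((∃ m : ℤ, 1/α = m) →
      variance (fun ω => (U ω : ℝ)) μ = (1 - α^2) / (12 * α^2)) := by
  have hα0 : 0 < α := hα.1
  obtain ⟨n, hn⟩ : ∃ n : ℕ, ⌊1 / α⌋ = n :=
    Int.eq_ofNat_of_zero_le (Int.floor_nonneg.2 (by positivity))
  have hnα : 0 ≤ 1 - n * α := by
    have h : (n : ℝ) ≤ 1 / α := by
      have := Int.floor_le (1 / α)
      rwa [hn, Int.cast_natCast] at this
    have := (le_div_iff₀ hα0).1 h
    linarith
  have hsupp : ∀ᵐ ω ∂μ, U ω ∈ Set.Icc (0 : ℤ) n := by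
    have h : ∀ᵐ ω ∂μ, ∀ l : ℤ, l ∉ Set.Icc (0 : ℤ) n → U ω ≠ l := by
      rw [ae_all_iff]
      intro l
      by_cases hl : l ∈ Set.Icc (0 : ℤ) n
      · simp [hl]
      · have hzero : uPMF α l = 0 := by
          simp only [Set.mem_Icc] at hl
          rw [uPMF, hn, if_neg (by omega), if_neg (by omega)]
        have : μ {ω | U ω = l} = 0 := by rw [hdist, hzero, ENNReal.ofReal_zero]
        filter_upwards [measure_eq_zero_iff_ae_notMem.1 this] with ω hω _ using hω
    filter_upwards [h] with ω hω
    by_contra hl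
    exact hω _ hl rfl
  have hreal_lt (l : ℕ) (hl : l < n) : μ.real {ω | U ω = l} = α := by
    rw [measureReal_def, hdist, uPMF, hn, if_pos (by omega), ENNReal.toReal_ofReal hα0.le]
  have hreal_last : μ.real {ω | U ω = n} = 1 - n * α := by
    rw [measureReal_def, hdist, uPMF, hn, if_neg (by omega), if_pos rfl, Int.cast_natCast,
      ENNReal.toReal_ofReal hnα]
  have hint (f : ℤ → ℝ) : ∫ ω, f (U ω) ∂μ =
      α * ∑ l ∈ Finset.range n, f l + (1 - n * α) * f n := by
    rw [integral_comp_eq_sum_range hU hsupp, Finset.sum_range_succ, hreal_last, Finset.mul_sum]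
    congr 1
    exact Finset.sum_congr rfl fun l hl => by rw [hreal_lt l (Finset.mem_range.1 hl)]
  have hmem : MemLp (fun ω => (U ω : ℝ)) 2 μ := by
    refine MemLp.of_bound (by fun_prop) n ?_
    filter_upwards [hsupp] with ω hω
    rw [Real.norm_of_nonneg (by exact_mod_cast hω.1)]
    exact_mod_cast hω.2
  have hvar : variance (fun ω => (U ω : ℝ)) μ =
      (1/12) * n * (n + 1) * α * (2 + 4 * n - 3 * α * n - 3 * α * n^2) := by
    rw [variance_eq_sub hmem]
    simp only [Pi.pow_apply]
    rw [hint fun l => (l : ℝ) ^ 2, hint fun l => (l : ℝ)]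
    simp only [Int.cast_natCast]
    rw [sum_range_cast_real, sum_range_cast_sq_real]
    ring
  refine ⟨by rw [hvar, hn, Int.cast_natCast], ?_⟩
  rintro ⟨m, hm⟩
  have hnα' : (n : ℝ) = 1 / α := by
    rw [hm, Int.floor_intCast] at hn
    rw [hm, hn, Int.cast_natCast]
  rw [hvar, hnα']
  field_simp
  ring
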